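/- arXiv:2409.00559 — 2 statements merged into one kernel-verified Lean document; each statement's English description precedes it below -/
import Mathlib

section
/- Let n ≥ 1 and let a, b : Fin n → ℝ satisfy 0 ≤ b_i ≤ a_i ≤ 1 for every i. Then (∏_{j} a_j) · ∑_{i} (1 − a_i) · ∏_{j < i} b_j ≥ (∏_{j} b_j) · (1 − ∏_{j} a_j). -/
/-- For `0 ≤ b ≤ a` on `s` and `t ⊆ s`, passing from `t` to `s` shrinks `∏ b` by at least as much
as `∏ a`. -/
theorem Finset.prod_mul_prod_le_prod_mul_prod_of_subset {ι : Type*} {s t : Finset ι}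
    {a b : ι → ℝ} (hts : t ⊆ s) (hb : ∀ i ∈ s, 0 ≤ b i) (hba : ∀ i ∈ s, b i ≤ a i) :
    (∏ i ∈ s, b i) * ∏ i ∈ t, a i ≤ (∏ i ∈ s, a i) * ∏ i ∈ t, b i := by
  classical
  rw [← Finset.prod_sdiff hts, ← Finset.prod_sdiff hts, mul_assoc, mul_assoc,
    mul_comm (∏ i ∈ t, b i)]
  refine mul_le_mul_of_nonneg_right ?_ (mul_nonneg ?_ ?_)
  · exact Finset.prod_le_prod (fun i hi => hb i (Finset.sdiff_subset hi))
      fun i hi => hba i (Finset.sdiff_subset hi)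
  · exact Finset.prod_nonneg fun i hi => (hb i (hts hi)).trans (hba i (hts hi))
  · exact Finset.prod_nonneg fun i hi => hb i (hts hi)

/-- The telescoping identity `1 - ∏ a = ∑ i, (1 - a i) * ∏ j < i, a j`. -/
theorem Fin.one_sub_prod_eq_sum {n : ℕ} (a : Fin n → ℝ) :
    1 - ∏ j, a j = ∑ i, (1 - a i) * ∏ j ∈ Finset.Iio i, a j := by
  have h := Finset.prod_one_sub_ordered Finset.univ fun i => 1 - a i
  simp only [sub_sub_cancel, Finset.filter_gt_eq_Iio] at h
  rw [h, sub_sub_cancel]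

/-- Key inequality (Equation (b1)) in the alternative single-sample prophet
inequality proof: for `0 ≤ b i ≤ a i ≤ 1`,
`(∏ j, a j) * ∑ i, (1 - a i) * ∏ j < i, b j ≥ (∏ j, b j) * (1 - ∏ j, a j)`. -/
theorem prod_mul_sum_ge (n : ℕ) (hn : 1 ≤ n) (a b : Fin n → ℝ)
    (hb_nonneg : ∀ i, 0 ≤ b i) (hba : ∀ i, b i ≤ a i) (ha_le : ∀ i, a i ≤ 1) :
    (∏ j, a j) * ∑ i, (1 - a i) * ∏ j ∈ Finset.Iio i, b j ≥
      (∏ j, b j) * (1 - ∏ j, a j) := by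
  rw [Fin.one_sub_prod_eq_sum, Finset.mul_sum, Finset.mul_sum, ge_iff_le]
  refine Finset.sum_le_sum fun i _ => ?_
  rw [mul_left_comm, mul_left_comm (∏ j, a j)]
  exact mul_le_mul_of_nonneg_left
    (Finset.prod_mul_prod_le_prod_mul_prod_of_subset (Finset.subset_univ _)
      (fun j _ => hb_nonneg j) fun j _ => hba j)
    (sub_nonneg.2 (ha_le i))
end

section
/- Let ρ ∈ (0,1) satisfy ρ·e^ρ = 1. Let n ≥ 1 and let z : Fin n → ℝ satisfy 0 ≤ z_i ≤ 1 for all i and ∑_i (1 − z_i) = ρ. Then 1 − ρ ≤ ∏_i z_i ≤ ρ, and consequently min(∏_i z_i, 1 − ∏_i z_i) ≥ 1 − ρ. -/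
/-- Weierstrass product inequality: for numbers in `[0, 1]`, the product is at least one minus
the sum of the complements. -/
theorem Finset.one_sub_sum_one_sub_le_prod {ι : Type*} (s : Finset ι) (z : ι → ℝ)
    (h0 : ∀ i ∈ s, 0 ≤ z i) (h1 : ∀ i ∈ s, z i ≤ 1) :
    1 - ∑ i ∈ s, (1 - z i) ≤ ∏ i ∈ s, z i := by
  classical
  induction s using Finset.induction_on with
  | empty => simp
  | insert a s ha ih =>
    rw [Finset.forall_mem_insert] at h0 h1
    rw [Finset.sum_insert ha, Finset.prod_insert ha]
    have hp : ∏ i ∈ s, z i ≤ 1 := Finset.prod_le_one h0.2 h1.2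
    nlinarith [ih h0.2 h1.2, mul_nonneg (sub_nonneg.2 h1.1) (sub_nonneg.2 hp)]

/-- A product of nonnegative reals is at most the exponential of minus the sum of the
complements. -/
theorem Finset.prod_le_exp_neg_sum_one_sub {ι : Type*} (s : Finset ι) (z : ι → ℝ)
    (h0 : ∀ i ∈ s, 0 ≤ z i) :
    ∏ i ∈ s, z i ≤ Real.exp (-∑ i ∈ s, (1 - z i)) := by
  rw [← Finset.sum_neg_distrib, Real.exp_sum]
  refine Finset.prod_le_prod h0 fun i _ ↦ ?_
  linarith [Real.add_one_le_exp (-(1 - z i))]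

/-- Combination of Claims 1–3 of Theorem 4.1: if `ρ ∈ (0,1)` satisfies `ρ·e^ρ = 1`,
`0 ≤ z i ≤ 1` for all `i`, and `∑ i, (1 - z i) = ρ`, then
`1 - ρ ≤ ∏ i, z i ≤ ρ` and `min (∏ i, z i) (1 - ∏ i, z i) ≥ 1 - ρ`. -/
theorem prod_bounds_of_sum_eq_rho (ρ : ℝ) (hρ0 : 0 < ρ) (hρ1 : ρ < 1)
    (hρ : ρ * Real.exp ρ = 1) (n : ℕ) (hn : 1 ≤ n) (z : Fin n → ℝ)
    (hz_nonneg : ∀ i, 0 ≤ z i) (hz_le : ∀ i, z i ≤ 1)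
    (hsum : ∑ i, (1 - z i) = ρ) :
    (1 - ρ ≤ ∏ i, z i ∧ ∏ i, z i ≤ ρ) ∧
      1 - ρ ≤ min (∏ i, z i) (1 - ∏ i, z i) := by
  have hlow : 1 - ρ ≤ ∏ i, z i :=
    hsum ▸ Finset.univ.one_sub_sum_one_sub_le_prod z (fun i _ ↦ hz_nonneg i) fun i _ ↦ hz_le i
  have hup : ∏ i, z i ≤ ρ := by
    have h := Finset.univ.prod_le_exp_neg_sum_one_sub z fun i _ ↦ hz_nonneg i
    rwa [hsum, Real.exp_neg, ← eq_inv_of_mul_eq_one_left hρ] at h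
  exact ⟨⟨hlow, hup⟩, le_min hlow (by linarith)⟩
end
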